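/- arXiv:1808.03530 — 2 statements merged into one kernel-verified Lean document; each statement's English description precedes it below -/
import Mathlib

section
/- If the point set {ξ_1,...,ξ_N} ⊂ S^q supports a quadrature rule with positive weights λ_i that is exact on P_{2n}, then the Marcinkiewicz-type inequality ∑_{i=1}^N λ_i |Q(ξ_i)| ≤ C ‖Q‖_{L^1(S^q)} holds for all Q ∈ P_n with a constant C depending only on q (not on n, N, or Q). -/
open MeasureTheory

/-- The surface measure on the unit sphere `S^q ⊂ ℝ^{q+1}`. -/
noncomputable def sphereMeasure (q : ℕ) :
    Measure (Metric.sphere (0 : EuclideanSpace ℝ (Fin (q + 1))) 1) :=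
  (volume : Measure (EuclideanSpace ℝ (Fin (q + 1)))).toSphere

/-- Evaluation of a polynomial in `q+1` variables on the unit sphere, as a linear map. -/
noncomputable def sphPolyMap (q : ℕ) :
    MvPolynomial (Fin (q + 1)) ℝ →ₗ[ℝ]
      ((Metric.sphere (0 : EuclideanSpace ℝ (Fin (q + 1))) 1) → ℝ) where
  toFun p := fun x => MvPolynomial.eval (fun i => (x : EuclideanSpace ℝ (Fin (q + 1))) i) p
  map_add' := by intros; funext; simp
  map_smul' := by intros; funext; simp [smul_eq_mul]

/-- `sphPoly q n` : the space `P_n` of spherical polynomials of degree at most `n` on `S^q`. -/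
noncomputable def sphPoly (q n : ℕ) :
    Submodule ℝ ((Metric.sphere (0 : EuclideanSpace ℝ (Fin (q + 1))) 1) → ℝ) :=
  (MvPolynomial.restrictTotalDegree (Fin (q + 1)) ℝ n).map (sphPolyMap q)

section ReproducingKernel

variable {X : Type*} [TopologicalSpace X] [CompactSpace X] [MeasurableSpace X] [BorelSpace X]
  (μ : Measure X) [IsFiniteMeasure μ]

theorem Continuous.integrable_of_isFiniteMeasure {f : X → ℝ} (hf : Continuous f) :
    Integrable f μ :=
  hf.integrable_of_hasCompactSupport (HasCompactSupport.of_compactSpace f)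

variable [μ.IsOpenPosMeasure]

/-- The `L²(μ)` inner product on a space of continuous functions. -/
noncomputable abbrev continuousL2Core (V : Submodule ℝ (X → ℝ)) (hV : ∀ f ∈ V, Continuous f) :
    InnerProductSpace.Core ℝ V where
  inner f g := ∫ x, (f : X → ℝ) x * (g : X → ℝ) x ∂μ
  conj_inner_symm f g := by simp [mul_comm]
  re_inner_nonneg f := integral_nonneg fun x => mul_self_nonneg ((f : X → ℝ) x)
  add_left f g h := by
    have hf := hV _ f.2
    have hg := hV _ g.2
    have hh := hV _ h.2
    simp only [Submodule.coe_add, Pi.add_apply, add_mul]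
    exact integral_add ((hf.mul hh).integrable_of_isFiniteMeasure μ)
      ((hg.mul hh).integrable_of_isFiniteMeasure μ)
  smul_left f g r := by
    simp [mul_assoc, integral_const_mul]
  definite f hf := by
    have hc := hV _ f.2
    have h0 := (integral_eq_zero_iff_of_nonneg
      (fun x => mul_self_nonneg ((f : X → ℝ) x))
      ((hc.mul hc).integrable_of_isFiniteMeasure μ)).1 hf
    have h1 := Measure.eq_of_ae_eq h0 (hc.mul hc) continuous_zero
    ext x
    simpa using congrFun h1 x

theorem exists_orthonormal_expansion (V : Submodule ℝ (X → ℝ)) [FiniteDimensional ℝ V]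
    (hV : ∀ f ∈ V, Continuous f) :
    ∃ e : Fin (Module.finrank ℝ V) → X → ℝ, (∀ i, e i ∈ V) ∧
      (∀ i, ∫ x, e i x * e i x ∂μ = 1) ∧
      ∀ f ∈ V, ∀ x, f x = ∑ i, (∫ y, f y * e i y ∂μ) * e i x := by
  let core := continuousL2Core μ V hV
  let : NormedAddCommGroup V := core.toNormedAddCommGroup
  let : InnerProductSpace ℝ V := InnerProductSpace.ofCore core.toCore
  let b := stdOrthonormalBasis ℝ V
  refine ⟨fun i => b i, fun i => (b i).2, fun i => ?_, fun f hf x => ?_⟩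
  · have h : inner ℝ (b i) (b i) = (1 : ℝ) := by
      rw [real_inner_self_eq_norm_sq, b.orthonormal.1 i, one_pow]
    exact h
  · have h := congrArg (fun v : V => (v : X → ℝ) x) (b.sum_repr' ⟨f, hf⟩)
    simp only [Submodule.coe_sum, Finset.sum_apply, Submodule.coe_smul, Pi.smul_apply,
      smul_eq_mul] at h
    rw [← h]
    refine Finset.sum_congr rfl fun i _ => ?_
    congr 1
    rw [real_inner_comm]
    rfl

/-- The reproducing kernel of a finite-dimensional space of continuous functions which is
invariant under a transitive family of measure-preserving maps is constant on the diagonal. -/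
theorem exists_reproducing_kernel (V : Submodule ℝ (X → ℝ)) [FiniteDimensional ℝ V]
    (hV : ∀ f ∈ V, Continuous f)
    (htrans : ∀ x y, ∃ g : X → X, g x = y ∧ Continuous g ∧ MeasurePreserving g μ μ ∧
      ∀ f ∈ V, f ∘ g ∈ V) :
    ∃ (K : X → X → ℝ) (c : ℝ), (∀ x, K x ∈ V) ∧ (∀ x y, K x y = K y x) ∧
      (∀ f ∈ V, ∀ x, f x = ∫ y, f y * K x y ∂μ) ∧ (∀ x, K x x = c) ∧
      (∀ x y, |K x y| ≤ c) ∧ c * μ.real Set.univ = Module.finrank ℝ V := by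
  obtain ⟨e, heV, heone, hexp⟩ := exists_orthonormal_expansion μ V hV
  let K : X → X → ℝ := fun x y => ∑ i, e i x * e i y
  have hK : ∀ x, K x ∈ V := fun x => by
    have : K x = ∑ i, e i x • e i := by
      ext y
      simp [K]
    rw [this]
    exact V.sum_mem fun i _ => V.smul_mem _ (heV i)
  have hsymm : ∀ x y, K x y = K y x := fun x y =>
    Finset.sum_congr rfl fun i _ => mul_comm _ _
  have hint : ∀ f ∈ V, ∀ g ∈ V, Integrable (fun y => f y * g y) μ := fun f hf g hg =>
    ((hV f hf).mul (hV g hg)).integrable_of_isFiniteMeasure μ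
  have hrep : ∀ f ∈ V, ∀ x, f x = ∫ y, f y * K x y ∂μ := fun f hf x => by
    simp only [K, Finset.mul_sum]
    rw [integral_finsetSum, hexp f hf x]
    · refine Finset.sum_congr rfl fun i _ => ?_
      rw [← integral_mul_const]
      exact integral_congr_ae (.of_forall fun y => by ring)
    · intro i _
      convert (hint f hf _ (heV i)).const_mul (e i x) using 2
      ring
  have hsq : ∀ f ∈ V, ∀ x, 0 ≤ (∫ y, f y * f y ∂μ) - 2 * f x + K x x := fun f hf x => by
    have h : ∫ y, (f y - K x y) * (f y - K x y) ∂μ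
        = (∫ y, f y * f y ∂μ) - 2 * f x + K x x := by
      have hexpand : ∀ y, (f y - K x y) * (f y - K x y)
          = f y * f y - 2 * (f y * K x y) + K x y * K x y := fun y => by ring
      simp_rw [hexpand]
      rw [integral_add, integral_sub, integral_const_mul, ← hrep f hf x, ← hrep _ (hK x) x]
      · exact hint f hf f hf
      · exact (hint f hf _ (hK x)).const_mul 2
      · exact (hint f hf f hf).sub ((hint f hf _ (hK x)).const_mul 2)
      · exact hint _ (hK x) _ (hK x)
    rw [← h]
    exact integral_nonneg fun y => mul_self_nonneg _
  have hle : ∀ x y, K y y ≤ K x x := fun x y => by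
    obtain ⟨g, hg, hgc, hgm, hgV⟩ := htrans x y
    have h := hsq _ (hgV _ (hK y)) x
    have hcomp : ∫ z, (K y ∘ g) z * (K y ∘ g) z ∂μ = K y y := by
      rw [hrep _ (hK y) y]
      have hcont := (hV _ (hK y)).mul (hV _ (hK y))
      have hmap := integral_map (μ := μ) hgc.measurable.aemeasurable
        hcont.aestronglyMeasurable
      rw [hgm.map_eq] at hmap
      exact hmap.symm
    rw [hcomp, Function.comp_apply, hg] at h
    linarith
  have hdiag : ∀ x, K x x * μ.real Set.univ = Module.finrank ℝ V := fun x => by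
    have h : ∫ y, K y y ∂μ = K x x * μ.real Set.univ := by
      rw [integral_congr_ae (.of_forall fun y => le_antisymm (hle x y) (hle y x))]
      simp [mul_comm]
    rw [← h]
    simp only [K]
    rw [integral_finsetSum _ fun i _ => hint _ (heV i) _ (heV i)]
    simp [heone]
  rcases isEmpty_or_nonempty X with hX | ⟨⟨x₀⟩⟩
  · refine ⟨K, 0, hK, hsymm, hrep, fun x => isEmptyElim x, fun x => isEmptyElim x, ?_⟩
    have : Subsingleton V := ⟨fun f g => Subtype.ext (funext fun x => isEmptyElim x)⟩
    simp [Module.finrank_zero_of_subsingleton]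
  · have hc : ∀ x, K x x = K x₀ x₀ := fun x => le_antisymm (hle x₀ x) (hle x x₀)
    refine ⟨K, K x₀ x₀, hK, hsymm, hrep, hc, fun x y => ?_, hdiag x₀⟩
    have h1 := hsq _ (hK x) y
    have h2 := hsq _ (V.neg_mem (hK x)) y
    simp only [Pi.neg_apply, neg_mul_neg] at h2
    rw [← hrep _ (hK x) x, hc x, hc y] at h1 h2
    exact abs_le.2 ⟨by linarith, by linarith⟩

/-- Marcinkiewicz inequality for invariant function spaces `V` and `W ⊇ V · V · V`, with constant
`dim W / dim V`. -/
theorem sum_abs_le_of_quadrature (V W : Submodule ℝ (X → ℝ)) [FiniteDimensional ℝ V]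
    [FiniteDimensional ℝ W] (hV : ∀ f ∈ V, Continuous f) (hW : ∀ f ∈ W, Continuous f)
    (hVtrans : ∀ x y, ∃ g : X → X, g x = y ∧ Continuous g ∧ MeasurePreserving g μ μ ∧
      ∀ f ∈ V, f ∘ g ∈ V)
    (hWtrans : ∀ x y, ∃ g : X → X, g x = y ∧ Continuous g ∧ MeasurePreserving g μ μ ∧
      ∀ f ∈ W, f ∘ g ∈ W)
    (hVW : ∀ f ∈ V, ∀ g ∈ V, ∀ h ∈ V, f * (g * h) ∈ W) (hpos : 0 < Module.finrank ℝ V)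
    {ι : Type*} [Fintype ι] (ξ : ι → X) (w : ι → ℝ) (hw : ∀ i, 0 < w i)
    (hquad : ∀ f ∈ V, ∀ g ∈ V, ∑ i, w i * (f (ξ i) * g (ξ i)) = ∫ x, f x * g x ∂μ)
    (Q : X → ℝ) (hQ : Q ∈ V) :
    Module.finrank ℝ V * ∑ i, w i * |Q (ξ i)| ≤ Module.finrank ℝ W * ∫ x, |Q x| ∂μ := by
  obtain ⟨K, k, hK, hKsymm, hKrep, hKdiag, -, hk⟩ := exists_reproducing_kernel μ V hV hVtrans
  obtain ⟨L, l, hL, -, hLrep, -, hLle, hl⟩ := exists_reproducing_kernel μ W hW hWtrans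
  have hkpos : 0 < k := by
    refine pos_of_mul_pos_left (b := μ.real Set.univ) ?_ measureReal_nonneg
    rw [hk]
    exact_mod_cast hpos
  have hQc := hV Q hQ
  have hint : ∀ x, Integrable (fun y => |Q y| * (K x y * K x y)) μ := fun x =>
    (hQc.abs.mul ((hV _ (hK x)).mul (hV _ (hK x)))).integrable_of_isFiniteMeasure μ
  have hpoint : ∀ x, |Q x| * k ^ 2 ≤ l * ∫ y, |Q y| * (K x y * K x y) ∂μ := fun x => by
    have hmem := hVW Q hQ _ (hK x) _ (hK x)
    have h := hLrep _ hmem x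
    simp only [Pi.mul_apply, hKdiag] at h
    calc |Q x| * k ^ 2 = |Q x * (k * k)| := by
          rw [abs_mul, abs_of_pos (mul_pos hkpos hkpos), sq]
      _ ≤ ∫ y, |Q y * (K x y * K x y) * L x y| ∂μ := by
          rw [h]
          exact abs_integral_le_integral_abs
      _ ≤ ∫ y, l * (|Q y| * (K x y * K x y)) ∂μ := by
          refine integral_mono ?_ ((hint x).const_mul l) fun y => ?_
          · exact (((hW _ hmem).mul (hW _ (hL x))).abs).integrable_of_isFiniteMeasure μ
          · have hnn : 0 ≤ |Q y| * (K x y * K x y) :=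
              mul_nonneg (abs_nonneg _) (mul_self_nonneg _)
            have := mul_le_mul_of_nonneg_left (hLle x y) hnn
            simp only [abs_mul, abs_mul_abs_self] at this ⊢
            linarith
      _ = l * ∫ y, |Q y| * (K x y * K x y) ∂μ := integral_const_mul _ _
  have hsum : (∑ i, w i * |Q (ξ i)|) * k ^ 2 ≤ (l * ∫ y, |Q y| ∂μ) * k := by
    calc (∑ i, w i * |Q (ξ i)|) * k ^ 2 = ∑ i, w i * (|Q (ξ i)| * k ^ 2) := by
          rw [Finset.sum_mul]
          exact Finset.sum_congr rfl fun i _ => by ring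
      _ ≤ ∑ i, w i * (l * ∫ y, |Q y| * (K (ξ i) y * K (ξ i) y) ∂μ) :=
          Finset.sum_le_sum fun i _ => mul_le_mul_of_nonneg_left (hpoint _) (hw i).le
      _ = l * ∑ i, ∫ y, w i * (|Q y| * (K (ξ i) y * K (ξ i) y)) ∂μ := by
          rw [Finset.mul_sum]
          refine Finset.sum_congr rfl fun i _ => ?_
          rw [integral_const_mul]
          ring
      _ = l * ∫ y, |Q y| * k ∂μ := by
          rw [← integral_finsetSum _ fun i _ => (hint _).const_mul (w i)]
          congr 1
          refine integral_congr_ae (.of_forall fun y => ?_)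
          have h := hquad _ (hK y) _ (hK y)
          rw [← hKrep _ (hK y) y, hKdiag] at h
          simp only [← h, Finset.mul_sum]
          refine Finset.sum_congr rfl fun i _ => ?_
          rw [hKsymm y (ξ i)]
          ring
      _ = (l * ∫ y, |Q y| ∂μ) * k := by
          rw [integral_mul_const]
          ring
  have hdiv : k * ∑ i, w i * |Q (ξ i)| ≤ l * ∫ y, |Q y| ∂μ :=
    le_of_mul_le_mul_right (by linarith) hkpos
  rw [← hk, ← hl]
  nlinarith [mul_le_mul_of_nonneg_right hdiv (measureReal_nonneg (μ := μ) (s := Set.univ))]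

end ReproducingKernel

section Sphere

variable {E : Type*} [NormedAddCommGroup E]

/-- The self-map of the unit sphere induced by a linear isometry equivalence. -/
def LinearIsometryEquiv.sphereMap [NormedSpace ℝ E] (g : E ≃ₗᵢ[ℝ] E) :
    Metric.sphere (0 : E) 1 → Metric.sphere (0 : E) 1 :=
  fun x => ⟨g x, by simp⟩

theorem LinearIsometryEquiv.continuous_sphereMap [NormedSpace ℝ E] (g : E ≃ₗᵢ[ℝ] E) :
    Continuous g.sphereMap :=
  (g.continuous.comp continuous_subtype_val).subtype_mk _

open scoped Pointwise in
theorem LinearIsometryEquiv.measurePreserving_sphereMap [InnerProductSpace ℝ E]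
    [FiniteDimensional ℝ E] [MeasurableSpace E] [BorelSpace E] (g : E ≃ₗᵢ[ℝ] E) :
    MeasurePreserving g.sphereMap (volume : Measure E).toSphere
      (volume : Measure E).toSphere := by
  refine ⟨g.continuous_sphereMap.measurable, Measure.ext fun s hs => ?_⟩
  have hs' := g.continuous_sphereMap.measurable hs
  rw [Measure.map_apply g.continuous_sphereMap.measurable hs, Measure.toSphere_apply' _ hs',
    Measure.toSphere_apply' _ hs]
  congr 1
  have hpre : Set.Ioo (0 : ℝ) 1 • ((↑) '' (g.sphereMap ⁻¹' s) : Set E)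
      = g ⁻¹' (Set.Ioo (0 : ℝ) 1 • ((↑) '' s : Set E)) := by
    ext z
    simp only [Set.mem_smul, Set.mem_preimage, Set.mem_image]
    constructor
    · rintro ⟨r, hr, _, ⟨x, hx, rfl⟩, rfl⟩
      exact ⟨r, hr, g x, ⟨_, hx, rfl⟩, by simp⟩
    · rintro ⟨r, hr, _, ⟨x, hx, rfl⟩, hz⟩
      refine ⟨r, hr, g.symm x, ⟨⟨g.symm x, by simp⟩, ?_, rfl⟩, ?_⟩
      · simpa [LinearIsometryEquiv.sphereMap] using hx
      · rw [← map_smul, hz, g.symm_apply_apply]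
  rw [hpre]
  exact g.measurePreserving.measure_preimage_equiv (f := g.toMeasurableEquiv) _

end Sphere

section SphericalPolynomials

variable {q : ℕ}

theorem mem_sphPoly {n : ℕ} {f : Metric.sphere (0 : EuclideanSpace ℝ (Fin (q + 1))) 1 → ℝ} :
    f ∈ sphPoly q n ↔ ∃ p : MvPolynomial (Fin (q + 1)) ℝ, p.totalDegree ≤ n ∧
      sphPolyMap q p = f := by
  simp [sphPoly, Submodule.mem_map, MvPolynomial.mem_restrictTotalDegree]

theorem sphPolyMap_mul (p r : MvPolynomial (Fin (q + 1)) ℝ) :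
    sphPolyMap q (p * r) = sphPolyMap q p * sphPolyMap q r := by
  funext x
  simp [sphPolyMap]

instance finiteDimensional_sphPoly (q n : ℕ) : FiniteDimensional ℝ (sphPoly q n) := by
  unfold sphPoly
  infer_instance

theorem continuous_of_mem_sphPoly {n : ℕ}
    {f : Metric.sphere (0 : EuclideanSpace ℝ (Fin (q + 1))) 1 → ℝ} (hf : f ∈ sphPoly q n) :
    Continuous f := by
  obtain ⟨p, -, rfl⟩ := mem_sphPoly.1 hf
  exact (MvPolynomial.continuous_eval p).comp (by fun_prop)

theorem mul_mem_sphPoly {m n : ℕ}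
    {f g : Metric.sphere (0 : EuclideanSpace ℝ (Fin (q + 1))) 1 → ℝ}
    (hf : f ∈ sphPoly q m) (hg : g ∈ sphPoly q n) : f * g ∈ sphPoly q (m + n) := by
  obtain ⟨p, hp, rfl⟩ := mem_sphPoly.1 hf
  obtain ⟨r, hr, rfl⟩ := mem_sphPoly.1 hg
  exact mem_sphPoly.2 ⟨p * r, (MvPolynomial.totalDegree_mul p r).trans (add_le_add hp hr),
    sphPolyMap_mul p r⟩

theorem MvPolynomial.totalDegree_aeval_le_of_totalDegree_le_one {σ τ R : Type*} [CommSemiring R]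
    (l : σ → MvPolynomial τ R) (hl : ∀ i, (l i).totalDegree ≤ 1) (p : MvPolynomial σ R) :
    (aeval l p).totalDegree ≤ p.totalDegree := by
  rw [aeval_def, eval₂_eq]
  refine totalDegree_finsetSum_le fun d hd => (totalDegree_mul _ _).trans ?_
  rw [algebraMap_eq, totalDegree_C, zero_add]
  refine (totalDegree_finsetProd _ _).trans (le_trans ?_ (le_totalDegree hd))
  exact Finset.sum_le_sum fun i _ => (totalDegree_pow _ _).trans
    (by simpa using Nat.mul_le_mul_left (d i) (hl i))

theorem comp_sphereMap_mem_sphPoly {n : ℕ}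
    (g : EuclideanSpace ℝ (Fin (q + 1)) ≃ₗᵢ[ℝ] EuclideanSpace ℝ (Fin (q + 1)))
    {f : Metric.sphere (0 : EuclideanSpace ℝ (Fin (q + 1))) 1 → ℝ} (hf : f ∈ sphPoly q n) :
    f ∘ g.sphereMap ∈ sphPoly q n := by
  obtain ⟨p, hp, rfl⟩ := mem_sphPoly.1 hf
  let l : Fin (q + 1) → MvPolynomial (Fin (q + 1)) ℝ := fun i =>
    ∑ j, MvPolynomial.C (g (EuclideanSpace.single j 1) i) * MvPolynomial.X j
  have hl : ∀ i, (l i).totalDegree ≤ 1 := fun i =>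
    MvPolynomial.totalDegree_finsetSum_le fun j _ => (MvPolynomial.totalDegree_mul _ _).trans
      (by simp)
  refine mem_sphPoly.2 ⟨MvPolynomial.aeval l p,
    (MvPolynomial.totalDegree_aeval_le_of_totalDegree_le_one l hl p).trans hp, ?_⟩
  funext x
  have hx : (x : EuclideanSpace ℝ (Fin (q + 1)))
      = ∑ j, (x : EuclideanSpace ℝ (Fin (q + 1))) j • EuclideanSpace.single j (1 : ℝ) := by
    ext i
    simp [Finset.sum_apply, Pi.single_apply]
  have hgx : ∀ i, MvPolynomial.eval (fun i => (x : EuclideanSpace ℝ (Fin (q + 1))) i) (l i)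
      = g x i := fun i => by
    conv_rhs => rw [hx]
    simp [l, map_sum, mul_comm]
  simp only [sphPolyMap, LinearMap.coe_mk, AddHom.coe_mk, Function.comp_apply,
    LinearIsometryEquiv.sphereMap, ← hgx]
  rw [← MvPolynomial.coe_aeval_eq_eval, ← MvPolynomial.coe_aeval_eq_eval]
  simp only [RingHom.coe_coe]
  rw [← AlgHom.comp_apply, MvPolynomial.comp_aeval]

theorem sphPoly_transitive (n : ℕ) (x y : Metric.sphere (0 : EuclideanSpace ℝ (Fin (q + 1))) 1) :
    ∃ g : Metric.sphere (0 : EuclideanSpace ℝ (Fin (q + 1))) 1 →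
        Metric.sphere (0 : EuclideanSpace ℝ (Fin (q + 1))) 1,
      g x = y ∧ Continuous g ∧ MeasurePreserving g (sphereMeasure q) (sphereMeasure q) ∧
      ∀ f ∈ sphPoly q n, f ∘ g ∈ sphPoly q n := by
  let g := (Submodule.span ℝ {(x : EuclideanSpace ℝ (Fin (q + 1))) - y})ᗮ.reflection
  refine ⟨g.sphereMap, Subtype.ext ?_, g.continuous_sphereMap, g.measurePreserving_sphereMap,
    fun f hf => comp_sphereMap_mem_sphPoly g hf⟩
  exact Submodule.reflection_sub (by simp)

theorem finrank_sphPoly_pos (q n : ℕ) : 0 < Module.finrank ℝ (sphPoly q n) := by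
  have h1 : sphPolyMap q 1 ∈ sphPoly q n := mem_sphPoly.2 ⟨1, by simp, rfl⟩
  refine Module.finrank_pos_iff_exists_ne_zero.2 ⟨⟨_, h1⟩, fun h => ?_⟩
  have h2 := congrFun (congrArg Subtype.val h) ⟨EuclideanSpace.single 0 1, by simp⟩
  simp [sphPolyMap] at h2

/-- Writing exponents as `m * β + γ` with `m ≈ n / (q + 1)` covers `P_{3n}` by boundedly many
monomial multiples of `P_n`. -/
theorem finrank_sphPoly_three_mul_le (q n : ℕ) :
    Module.finrank ℝ (sphPoly q (3 * n)) ≤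
      (3 * q + 4) ^ (q + 1) * Module.finrank ℝ (sphPoly q n) := by
  set m := n / (q + 1) + 1 with hm
  have hm0 : 0 < m := Nat.succ_pos _
  have hlow : (q + 1) * (m - 1) ≤ n := by simpa [hm] using Nat.mul_div_le n (q + 1)
  have hup : n < (q + 1) * m := Nat.lt_mul_div_succ n (Nat.succ_pos q)
  let mono : (Fin (q + 1) → Fin (3 * q + 4)) → MvPolynomial (Fin (q + 1)) ℝ := fun β =>
    MvPolynomial.monomial (Finsupp.equivFunOnFinite.symm fun i => m * (β i : ℕ)) 1
  let φ : ((Fin (q + 1) → Fin (3 * q + 4)) → sphPoly q n) →ₗ[ℝ]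
      (Metric.sphere (0 : EuclideanSpace ℝ (Fin (q + 1))) 1 → ℝ) :=
    ∑ β, LinearMap.mulLeft ℝ (sphPolyMap q (mono β)) ∘ₗ (sphPoly q n).subtype ∘ₗ
      LinearMap.proj β
  have hφ : sphPoly q (3 * n) ≤ LinearMap.range φ := by
    intro f hf
    obtain ⟨p, hp, rfl⟩ := mem_sphPoly.1 hf
    rw [p.as_sum, map_sum]
    refine Submodule.sum_mem _ fun α hα => ?_
    have hα3 : ∑ i, α i ≤ 3 * n := by
      refine le_trans ?_ ((MvPolynomial.le_totalDegree hα).trans hp)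
      rw [Finsupp.sum_fintype _ _ fun _ => rfl]
    have hβ : ∀ i, α i / m < 3 * q + 4 := fun i => by
      have hi : α i ≤ 3 * n :=
        (Finset.single_le_sum (fun _ _ => Nat.zero_le _) (Finset.mem_univ i)).trans hα3
      refine Nat.div_lt_of_lt_mul ?_
      nlinarith
    let β : Fin (q + 1) → Fin (3 * q + 4) := fun i => ⟨α i / m, hβ i⟩
    let r : MvPolynomial (Fin (q + 1)) ℝ :=
      MvPolynomial.monomial (Finsupp.equivFunOnFinite.symm fun i => α i % m) (p.coeff α)
    have hr : sphPolyMap q r ∈ sphPoly q n := by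
      refine mem_sphPoly.2 ⟨r, (MvPolynomial.totalDegree_monomial_le _ _).trans ?_, rfl⟩
      rw [Finsupp.sum_fintype _ _ fun _ => rfl]
      calc ∑ i, α i % m ≤ ∑ _i : Fin (q + 1), (m - 1) :=
            Finset.sum_le_sum fun i _ => Nat.le_sub_one_of_lt (Nat.mod_lt _ hm0)
        _ = (q + 1) * (m - 1) := by simp
        _ ≤ n := hlow
    refine ⟨Pi.single β ⟨_, hr⟩, ?_⟩
    simp only [φ, LinearMap.sum_apply, LinearMap.comp_apply, LinearMap.proj_apply]
    rw [Finset.sum_eq_single β]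
    · simp only [Pi.single_eq_same, Submodule.subtype_apply, LinearMap.mulLeft_apply,
        ← sphPolyMap_mul, mono, r, MvPolynomial.monomial_mul, one_mul]
      have hαβ : (Finsupp.equivFunOnFinite.symm fun i => m * (β i : ℕ)) +
          (Finsupp.equivFunOnFinite.symm fun i => α i % m) = α := by
        ext i
        simp [β, Nat.div_add_mod]
      rw [hαβ]
    · intro γ _ hγ
      simp [Pi.single_eq_of_ne hγ]
    · simp
  calc Module.finrank ℝ (sphPoly q (3 * n)) ≤ Module.finrank ℝ (LinearMap.range φ) :=
        Submodule.finrank_mono hφ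
    _ ≤ Module.finrank ℝ ((Fin (q + 1) → Fin (3 * q + 4)) → sphPoly q n) :=
        LinearMap.finrank_range_le φ
    _ = (3 * q + 4) ^ (q + 1) * Module.finrank ℝ (sphPoly q n) := by
        simp [Module.finrank_pi_fintype]

end SphericalPolynomials

/-- Marcinkiewicz-type inequality: there is a constant `C > 0` depending only on `q` such
that whenever points `ξ i ∈ S^q` and positive weights `lam i` give a quadrature rule exact on
`P_{2n}`, then `∑_i lam i * |Q (ξ i)| ≤ C * ‖Q‖_{L¹(S^q)}` for every `Q ∈ P_n`. -/
theorem marcinkiewicz_of_quadrature (q : ℕ) (hq : 2 ≤ q) :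
    ∃ C : ℝ, 0 < C ∧ ∀ (n N : ℕ)
      (ξ : Fin N → Metric.sphere (0 : EuclideanSpace ℝ (Fin (q + 1))) 1)
      (lam : Fin N → ℝ), (∀ i, 0 < lam i) →
      (∀ f ∈ sphPoly q (2 * n),
        ∑ i : Fin N, lam i * f (ξ i) = ∫ x, f x ∂(sphereMeasure q)) →
      ∀ Q ∈ sphPoly q n,
        ∑ i : Fin N, lam i * |Q (ξ i)| ≤ C * ∫ x, |Q x| ∂(sphereMeasure q) := by
  refine ⟨(3 * q + 4) ^ (q + 1), by positivity, fun n N ξ lam hlam hquad Q hQ => ?_⟩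
  have : IsFiniteMeasure (sphereMeasure q) := by
    unfold sphereMeasure
    infer_instance
  have : (sphereMeasure q).IsOpenPosMeasure := by
    unfold sphereMeasure
    infer_instance
  have hdpos := finrank_sphPoly_pos q n
  have hmain := sum_abs_le_of_quadrature (sphereMeasure q) (sphPoly q n) (sphPoly q (3 * n))
    (fun _ => continuous_of_mem_sphPoly) (fun _ => continuous_of_mem_sphPoly)
    (sphPoly_transitive n) (sphPoly_transitive (3 * n))
    (fun f hf g hg h hh => by
      have := mul_mem_sphPoly hf (mul_mem_sphPoly hg hh)
      rwa [show n + (n + n) = 3 * n by ring] at this)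
    hdpos ξ lam hlam
    (fun f hf g hg => hquad (f * g) (by
      have := mul_mem_sphPoly hf hg
      rwa [← two_mul] at this)) Q hQ
  have hdim : (Module.finrank ℝ (sphPoly q (3 * n)) : ℝ) ≤
      (3 * q + 4) ^ (q + 1) * Module.finrank ℝ (sphPoly q n) := by
    exact_mod_cast finrank_sphPoly_three_mul_le q n
  have hnonneg : 0 ≤ ∫ x, |Q x| ∂(sphereMeasure q) := integral_nonneg fun _ => abs_nonneg _
  refine le_of_mul_le_mul_left (hmain.trans ?_) (Nat.cast_pos.2 hdpos : (0 : ℝ) < _)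
  calc _ ≤ _ := mul_le_mul_of_nonneg_right hdim hnonneg
    _ = _ := by ring
end

section
/- If a positive-weight quadrature rule ∑_{i=1}^N λ_i f(ξ_i) = ∫_{S^q} f dσ is exact on P_{2n}, then every weight satisfies λ_i ≤ C/n^q with C depending only on q. -/
open MeasureTheory

namespace MeasureTheory.Measure

variable {E : Type*} [NormedAddCommGroup E] [NormedSpace ℝ E] [MeasurableSpace E] [BorelSpace E]
  [FiniteDimensional ℝ E]

/-- A function on the unit sphere that is dominated along every ray of the unit ball by an
integrable nonnegative function `F` has integral at most `dim E` times that of `F`. -/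
theorem integral_toSphere_le [Nontrivial E] (μ : Measure E) [μ.IsAddHaarMeasure]
    {f : Metric.sphere (0 : E) 1 → ℝ} {F : E → ℝ} (hf : Continuous f) (hF : Integrable F μ)
    (hF0 : ∀ y, 0 ≤ F y)
    (h : ∀ (x : Metric.sphere (0 : E) 1) (r : ℝ), 0 < r → r < 1 → f x ≤ F (r • (x : E))) :
    ∫ x, f x ∂μ.toSphere ≤ Module.finrank ℝ E * ∫ y, F y ∂μ := by
  set ν := volumeIoiPow (Module.finrank ℝ E - 1)
  have hdim : 0 < Module.finrank ℝ E := Module.finrank_pos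
  let one : Set.Ioi (0 : ℝ) := ⟨1, Set.mem_Ioi.2 one_pos⟩
  have hν : ν (Set.Iio one) = ENNReal.ofReal (1 / Module.finrank ℝ E) := by
    simp only [ν, volumeIoiPow_apply_Iio, one, one_pow]
    rw [Nat.cast_pred hdim, sub_add_cancel]
  have hνr : ν.real (Set.Iio one) = 1 / Module.finrank ℝ E := by
    rw [measureReal_def, hν, ENNReal.toReal_ofReal (by positivity)]
  have hmp := μ.measurePreserving_homeomorphUnitSphereProd
  have hemb := (homeomorphUnitSphereProd E).measurableEmbedding
  let φ : Set.Ioi (0 : ℝ) → ℝ := (Set.Iio one).indicator 1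
  have hφ : Integrable φ ν :=
    (integrable_indicator_iff measurableSet_Iio).2
      (integrableOn_const (by rw [hν]; exact ENNReal.ofReal_ne_top))
  have hfi : Integrable f μ.toSphere :=
    hf.integrable_of_hasCompactSupport (HasCompactSupport.of_compactSpace f)
  have hprod : Integrable (fun z : Metric.sphere (0 : E) 1 × Set.Ioi (0 : ℝ) ↦ f z.1 * φ z.2)
      (μ.toSphere.prod ν) := hfi.mul_prod hφ
  have hFsub : Integrable (fun y : ({0}ᶜ : Set E) ↦ F y) (μ.comap (↑)) :=
    (integrableOn_iff_comap_subtypeVal (measurableSet_singleton (0 : E)).compl).1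
      (hF.integrableOn (s := {0}ᶜ))
  have hint : ∫ y : ({0}ᶜ : Set E), F y ∂(μ.comap (↑)) = ∫ y, F y ∂μ := by
    rw [integral_subtype_comap (measurableSet_singleton (0 : E)).compl, restrict_compl_singleton]
  have key : ∫ z, f z.1 * φ z.2 ∂(μ.toSphere.prod ν) ≤ ∫ y, F y ∂μ := by
    rw [← hmp.integral_comp hemb, ← hint]
    refine integral_mono ((hmp.integrable_comp_emb hemb).2 hprod) hFsub fun y ↦ ?_
    by_cases hy : (homeomorphUnitSphereProd E y).2 < one
    · have hφ1 : φ (homeomorphUnitSphereProd E y).2 = 1 := by simp [φ, hy]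
      have hy' : ‖(y : E)‖ < 1 := by simpa [one, ← Subtype.coe_lt_coe] using hy
      have hy0 : (y : E) ≠ 0 := y.2
      have := h (homeomorphUnitSphereProd E y).1 ‖(y : E)‖ (norm_pos_iff.2 hy0) hy'
      simpa [hφ1, smul_smul, hy0] using this
    · have hφ0 : φ (homeomorphUnitSphereProd E y).2 = 0 := by simp [φ, hy]
      simpa [hφ0] using hF0 y
  rw [integral_prod_mul f φ, integral_indicator measurableSet_Iio] at key
  simp only [Pi.one_apply, setIntegral_const, hνr, smul_eq_mul, mul_one] at key
  have hd : (0 : ℝ) < Module.finrank ℝ E := by exact_mod_cast hdim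
  rw [mul_one_div, div_le_iff₀ hd] at key
  linarith

end MeasureTheory.Measure

namespace Polynomial.Chebyshev

open Polynomial

theorem U_sq_add_U_sq (R : Type*) [CommRing R] (n : ℤ) (x : R) :
    (U R n).eval x ^ 2 + (U R (n + 1)).eval x ^ 2
      - 2 * x * (U R n).eval x * (U R (n + 1)).eval x = 1 := by
  have h := congrArg (eval (2 * x)) (S_sq_add_S_sq R n)
  simp only [← S_comp_two_mul_X]
  simpa using h

theorem one_sub_sq_mul_eval_U_sq_le_one (n : ℤ) (x : ℝ) :
    (1 - x ^ 2) * (U ℝ n).eval x ^ 2 ≤ 1 := by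
  nlinarith [U_sq_add_U_sq ℝ n x, sq_nonneg ((U ℝ (n + 1)).eval x - x * (U ℝ n).eval x)]

theorem abs_eval_U_le (n : ℕ) {x : ℝ} (hx : |x| ≤ 1) : |(U ℝ n).eval x| ≤ n + 1 := by
  induction n with
  | zero => simp
  | succ n ih =>
    have h := congrArg (eval x) (U_eq_X_mul_U_add_T ℝ n)
    simp only [eval_add, eval_mul, eval_X] at h
    push_cast
    rw [h]
    calc _ ≤ |x| * |(U ℝ n).eval x| + |(T ℝ (n + 1)).eval x| := by
          rw [← abs_mul]; exact abs_add_le _ _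
      _ ≤ 1 * (n + 1) + 1 := by
          gcongr
          exact abs_eval_T_real_le_one _ hx
      _ = _ := by ring

/-- The square of the normalized Chebyshev polynomial of the second kind decays like
`(1 + (n + 1)² (1 - x²))⁻¹` on `[-1, 1]`. -/
theorem eval_U_div_sq_mul_le_two (n : ℕ) {x : ℝ} (hx : |x| ≤ 1) :
    ((U ℝ n).eval x / (n + 1)) ^ 2 * (1 + (n + 1) ^ 2 * (1 - x ^ 2)) ≤ 2 := by
  have h1 := one_sub_sq_mul_eval_U_sq_le_one n x
  have h2 := sq_le_sq.2 ((abs_eval_U_le n hx).trans (le_abs_self _))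
  have hn : (0 : ℝ) < (n + 1) ^ 2 := by positivity
  have h3 : ((U ℝ n).eval x / (n + 1)) ^ 2 ≤ 1 := by
    rw [div_pow]; exact (div_le_one hn).2 h2
  have h4 : ((U ℝ n).eval x / (n + 1)) ^ 2 * (n + 1) ^ 2 = (U ℝ n).eval x ^ 2 := by
    rw [div_pow]; field_simp
  calc _ = ((U ℝ n).eval x / (n + 1)) ^ 2
        + ((U ℝ n).eval x / (n + 1)) ^ 2 * (n + 1) ^ 2 * (1 - x ^ 2) := by ring
    _ ≤ 2 := by rw [h4]; linarith

end Polynomial.Chebyshev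

/-- A polynomial in the linear form `⟪·, ξ⟫` is a spherical polynomial of the same degree. -/
theorem comp_inner_mem_sphPoly {q m : ℕ} (ξ : EuclideanSpace ℝ (Fin (q + 1))) (p : Polynomial ℝ)
    (hp : p.natDegree ≤ m) :
    (fun x : Metric.sphere (0 : EuclideanSpace ℝ (Fin (q + 1))) 1 ↦
      p.eval (inner ℝ ξ (x : EuclideanSpace ℝ (Fin (q + 1))))) ∈ sphPoly q m := by
  let L : MvPolynomial (Fin (q + 1)) ℝ := ∑ i, MvPolynomial.C (ξ i) * MvPolynomial.X i
  have hL : L.totalDegree ≤ 1 := by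
    refine MvPolynomial.totalDegree_finsetSum_le fun i _ ↦ ?_
    refine (MvPolynomial.totalDegree_mul _ _).trans ?_
    simp
  refine ⟨Polynomial.aeval L p, ?_, ?_⟩
  · rw [SetLike.mem_coe, MvPolynomial.mem_restrictTotalDegree, Polynomial.aeval_eq_sum_range]
    refine MvPolynomial.totalDegree_finsetSum_le fun i hi ↦ ?_
    refine (MvPolynomial.totalDegree_smul_le _ _).trans ((MvPolynomial.totalDegree_pow _ _).trans ?_)
    have := Finset.mem_range.1 hi
    nlinarith
  · funext x
    change MvPolynomial.eval _ (Polynomial.aeval L p) = _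
    rw [← MvPolynomial.coe_aeval_eq_eval, AlgHom.coe_toRingHom,
      ← Polynomial.aeval_algHom_apply, Polynomial.coe_aeval_eq_eval]
    congr 1
    simp [L, PiLp.inner_apply, mul_comm]

/-- An orthonormal basis whose first vector is a given unit vector. -/
theorem exists_orthonormalBasis_zero_eq {q : ℕ}
    (ξ : Metric.sphere (0 : EuclideanSpace ℝ (Fin (q + 1))) 1) :
    ∃ b : OrthonormalBasis (Fin (q + 1)) ℝ (EuclideanSpace ℝ (Fin (q + 1))), b 0 = ξ := by
  have hv : Orthonormal ℝ (({0} : Set (Fin (q + 1))).domRestrict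
      fun _ ↦ (ξ : EuclideanSpace ℝ (Fin (q + 1)))) := by
    exact ⟨fun _ ↦ norm_eq_of_mem_sphere ξ, fun i j hij ↦ absurd (Subsingleton.elim i j) hij⟩
  obtain ⟨b, hb⟩ := hv.exists_orthonormalBasis_extension_of_card_eq (by simp)
  exact ⟨b, hb 0 rfl⟩

open Polynomial.Chebyshev in
/-- The normalized zonal kernel peaking at `ξ` has integral of order `(n + 1)^(-q)`. -/
theorem integral_zonal_le (q n : ℕ)
    (ξ : Metric.sphere (0 : EuclideanSpace ℝ (Fin (q + 1))) 1) :
    ∫ x : Metric.sphere (0 : EuclideanSpace ℝ (Fin (q + 1))) 1,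
      (((U ℝ n).eval (inner ℝ (ξ : EuclideanSpace ℝ (Fin (q + 1))) x) / (n + 1)) ^ 2) ^ q
        ∂(sphereMeasure q)
      ≤ (q + 1) * (2 * (2 * Real.pi / (n + 1)) ^ q) := by
  obtain ⟨b, hb⟩ := exists_orthonormalBasis_zero_eq ξ
  set K : ℝ := n + 1 with hK
  have hK0 : 0 < K := by positivity
  let φ : Fin (q + 1) → ℝ → ℝ :=
    Fin.cons ((Set.Icc (-1) 1).indicator 1) fun _ t ↦ 2 * (1 + (K * t) ^ 2)⁻¹
  have hφ0 : ∀ i t, 0 ≤ φ i t := by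
    intro i t
    refine Fin.cases ?_ (fun j ↦ ?_) i
    · exact Set.indicator_nonneg (fun _ _ ↦ zero_le_one) _
    · simp only [φ, Fin.cons_succ]; positivity
  have hφi : ∀ i, Integrable (φ i) := by
    intro i
    refine Fin.cases ?_ (fun j ↦ ?_) i
    · exact (integrable_indicator_iff measurableSet_Icc).2 (integrableOn_const (by simp))
    · exact (integrable_inv_one_add_sq.comp_mul_left' hK0.ne').const_mul 2
  have hint0 : ∫ t, φ 0 t = 2 := by
    simp only [φ, Fin.cons_zero]
    rw [integral_indicator measurableSet_Icc]
    simp only [Pi.one_def, setIntegral_const, smul_eq_mul, mul_one]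
    norm_num
  have hints : ∀ j : Fin q, ∫ t, φ j.succ t = 2 * Real.pi / K := by
    intro j
    simp only [φ, Fin.cons_succ]
    rw [integral_const_mul, Measure.integral_comp_mul_left (fun t : ℝ ↦ (1 + t ^ 2)⁻¹),
      integral_univ_inv_one_add_sq, abs_of_pos (by positivity), smul_eq_mul]
    field_simp
  let G : (Fin (q + 1) → ℝ) → ℝ := fun t ↦ ∏ i, φ i (t i)
  have hGi : Integrable G := Integrable.fintype_prod hφi
  have hG : ∫ t, G t = 2 * (2 * Real.pi / K) ^ q := by
    simp only [G]
    rw [integral_fintype_prod_volume_eq_prod, Fin.prod_univ_succ, hint0]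
    simp only [hints, Finset.prod_const, Finset.card_univ, Fintype.card_fin]
  let e := b.measurableEquiv.trans (MeasurableEquiv.toLp 2 (Fin (q + 1) → ℝ)).symm
  have he : MeasurePreserving e volume volume :=
    b.measurePreserving_measurableEquiv.trans (PiLp.volume_preserving_ofLp _)
  have heb : ∀ y i, e y i = inner ℝ (b i) y := fun y i ↦ b.repr_apply_apply y i
  have hle := Measure.integral_toSphere_le
    (volume : Measure (EuclideanSpace ℝ (Fin (q + 1))))
    (f := fun x ↦ (((U ℝ n).eval (inner ℝ (ξ : EuclideanSpace ℝ (Fin (q + 1))) x) / K) ^ 2) ^ q)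
    (F := G ∘ e) (by fun_prop) ((he.integrable_comp_emb e.measurableEmbedding).2 hGi)
    (fun y ↦ Finset.prod_nonneg fun i _ ↦ hφ0 i _) ?_
  · have h2 : ∫ y, (G ∘ e) y = ∫ t, G t := he.integral_comp e.measurableEmbedding G
    rw [h2, hG] at hle
    simpa [sphereMeasure] using hle
  · intro x r hr0 hr1
    have hx : ‖(x : EuclideanSpace ℝ (Fin (q + 1)))‖ = 1 := by simp
    have hs : |inner ℝ (b 0) (x : EuclideanSpace ℝ (Fin (q + 1)))| ≤ 1 := by
      refine (abs_real_inner_le_norm _ _).trans ?_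
      simp
    have hsum : 1 - inner ℝ (b 0) (x : EuclideanSpace ℝ (Fin (q + 1))) ^ 2
        = ∑ j : Fin q, inner ℝ (b j.succ) (x : EuclideanSpace ℝ (Fin (q + 1))) ^ 2 := by
      have := b.sum_sq_inner_right (x : EuclideanSpace ℝ (Fin (q + 1)))
      rw [hx, Fin.sum_univ_succ] at this
      linarith
    have hd := eval_U_div_sq_mul_le_two n hs
    rw [hsum, ← hK] at hd
    simp only [Function.comp_apply, G, heb, inner_smul_right, ← hb]
    rw [Fin.prod_univ_succ]
    have h0 : φ 0 (r * inner ℝ (b 0) (x : EuclideanSpace ℝ (Fin (q + 1)))) = 1 := by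
      simp only [φ, Fin.cons_zero]
      rw [Set.indicator_of_mem, Pi.one_apply]
      rw [Set.mem_Icc, ← abs_le, abs_mul, abs_of_pos hr0]
      nlinarith [abs_nonneg (inner ℝ (b 0) (x : EuclideanSpace ℝ (Fin (q + 1))))]
    rw [h0, one_mul]
    have hc : ∀ c : ℝ, c ^ q = ∏ _j : Fin q, c := by simp
    rw [hc]
    refine Finset.prod_le_prod (fun _ _ ↦ by positivity) fun j _ ↦ ?_
    simp only [φ, Fin.cons_succ]
    rw [← div_eq_mul_inv, le_div_iff₀ (by positivity)]
    refine le_trans ?_ hd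
    gcongr
    rw [mul_pow, mul_pow]
    gcongr
    calc _ ≤ 1 * inner ℝ (b j.succ) (x : EuclideanSpace ℝ (Fin (q + 1))) ^ 2 := by
          gcongr
          exact pow_le_one₀ hr0.le hr1.le
      _ ≤ _ := by
          rw [one_mul]
          exact Finset.single_le_sum
            (f := fun j : Fin q ↦ inner ℝ (b j.succ) (x : EuclideanSpace ℝ (Fin (q + 1))) ^ 2)
            (fun _ _ ↦ sq_nonneg _) (Finset.mem_univ j)

/-- There is a constant `C > 0` depending only on `q ≥ 2` such that whenever a positive-weight
quadrature rule on `S^q` is exact on `P_{2n}` (`n ≥ 1`), every weight satisfies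
`lam i ≤ C / n^q`. -/
theorem quadrature_weight_bound (q : ℕ) (hq : 2 ≤ q) :
    ∃ C : ℝ, 0 < C ∧ ∀ (n N : ℕ), 1 ≤ n →
      ∀ (ξ : Fin N → Metric.sphere (0 : EuclideanSpace ℝ (Fin (q + 1))) 1)
        (lam : Fin N → ℝ), (∀ i, 0 < lam i) →
        (∀ f ∈ sphPoly q (2 * n),
          ∑ i : Fin N, lam i * f (ξ i) = ∫ x, f x ∂(sphereMeasure q)) →
        ∀ i : Fin N, lam i ≤ C / (n : ℝ) ^ q := by
  have hq0 : (0 : ℝ) < q := by exact_mod_cast (by omega : 0 < q)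
  refine ⟨(q + 1) * (2 * (2 * Real.pi * q) ^ q), by positivity, ?_⟩
  intro n N hn ξ lam hlam hexact i
  have hn0 : (0 : ℝ) < n := by exact_mod_cast hn
  set k := n / q
  have hk : k * q ≤ n := Nat.div_mul_le_self n q
  have hkn : (n : ℝ) / q ≤ k + 1 := by
    rw [div_le_iff₀ hq0]
    exact_mod_cast (Nat.lt_mul_of_div_lt (Nat.lt_succ_self k) (by omega)).le
  let p : Polynomial ℝ :=
    ((Polynomial.C ((k : ℝ) + 1)⁻¹ * Polynomial.Chebyshev.U ℝ k) ^ 2) ^ q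
  have hp : p.natDegree ≤ 2 * n := by
    calc p.natDegree ≤ q * (2 * k) := by
          refine Polynomial.natDegree_pow_le_of_le q (Polynomial.natDegree_pow_le_of_le 2 ?_)
          refine (Polynomial.natDegree_C_mul_le _ _).trans ?_
          rw [Polynomial.Chebyshev.natDegree_U_natCast]
      _ ≤ 2 * n := by nlinarith
  have hpe : ∀ t, p.eval t = (((Polynomial.Chebyshev.U ℝ k).eval t / (k + 1)) ^ 2) ^ q := by
    intro t
    simp [p, div_eq_inv_mul]
  have hp1 : p.eval 1 = 1 := by
    have : (k : ℝ) + 1 ≠ 0 := by positivity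
    simp [hpe, this]
  have hsum := hexact _ (comp_inner_mem_sphPoly (ξ i : EuclideanSpace ℝ (Fin (q + 1))) p hp)
  simp only [hpe] at hsum
  have hint := integral_zonal_le q k (ξ i)
  rw [← hsum] at hint
  have hsingle := Finset.single_le_sum
    (f := fun j ↦ lam j * (((Polynomial.Chebyshev.U ℝ k).eval
      (inner ℝ (ξ i : EuclideanSpace ℝ (Fin (q + 1))) (ξ j)) / (k + 1)) ^ 2) ^ q)
    (fun j _ ↦ mul_nonneg (hlam j).le (by positivity)) (Finset.mem_univ i)
  have hii : inner ℝ (ξ i : EuclideanSpace ℝ (Fin (q + 1))) (ξ i) = (1 : ℝ) := by simp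
  simp only [hii, ← hpe, hp1, mul_one] at hsingle
  simp only [← hpe] at hint
  have hbase : 2 * Real.pi / ((k : ℝ) + 1) ≤ 2 * Real.pi * q / n := by
    rw [div_le_div_iff₀ (by positivity) hn0, mul_assoc _ (q : ℝ)]
    gcongr
    rwa [div_le_iff₀' hq0] at hkn
  calc lam i ≤ (q + 1) * (2 * (2 * Real.pi / (k + 1)) ^ q) := hsingle.trans hint
    _ ≤ (q + 1) * (2 * (2 * Real.pi * q / n) ^ q) := by gcongr
    _ = (q + 1) * (2 * (2 * Real.pi * q) ^ q) / (n : ℝ) ^ q := by rw [div_pow]; ring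
end
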